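/- There exists an absolute constant c₀ > 0 with the following property. Let (A_1, B_1), …, (A_N, B_N) be pairs of real numbers with 0 ≤ A_i ≤ C and 0 ≤ B_i ≤ C, C > 0, whose population variances satisfy ν_A − μ_A² ≥ c and ν_B − μ_B² ≥ c for some c > 0, and let ρ be the population Pearson correlation of the two columns. Let 0 < α < 1 and 0 < ε ≤ 1. If n pairs are sampled uniformly at random without replacement with n ≥ c₀ · C⁴ · ln(10/α) / (ε² · c²) (and n ≤ N), and r denotes Pearson's sample correlation coefficient of the sampled pairs, then with probability at least 1 − α, |r − ρ| ≤ ε. -/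

import Mathlib

open scoped Classical

lemma hs_step {ι : Type} [Fintype ι] (y : ι → ℝ) (hy : ∀ i, 0 ≤ y i)
    (T : Finset ι) (k : ι) (hk : k ∉ T) :
    (Fintype.card ι : ℝ) * ∑ σ : Equiv.Perm ι, ∏ j ∈ insert k T, y (σ j)
      ≤ (∑ i, y i) * ∑ σ : Equiv.Perm ι, ∏ j ∈ T, y (σ j) := by
  have h1 : (∑ i, y i) * ∑ σ : Equiv.Perm ι, ∏ j ∈ T, y (σ j)
      = ∑ l : ι, ∑ σ : Equiv.Perm ι, y (σ l) * ∏ j ∈ T, y (σ j) := by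
    rw [Finset.sum_comm, Finset.mul_sum]
    refine Finset.sum_congr rfl fun σ _ => ?_
    rw [← Finset.sum_mul, Equiv.sum_comp σ y]
  rw [h1]
  have h2 : (Fintype.card ι : ℝ) * ∑ σ : Equiv.Perm ι, ∏ j ∈ insert k T, y (σ j)
      = ∑ l : ι, ∑ σ : Equiv.Perm ι, ∏ j ∈ insert k T, y (σ j) := by
    rw [Finset.sum_const, nsmul_eq_mul, Finset.card_univ]
  rw [h2]
  refine Finset.sum_le_sum fun l _ => ?_
  simp_rw [Finset.prod_insert hk]
  by_cases hl : l ∈ T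
  · have hkl : k ≠ l := fun h => hk (h ▸ hl)
    have e1 : ∀ σ : Equiv.Perm ι, ∏ j ∈ T, y (σ j) = y (σ l) * ∏ j ∈ T.erase l, y (σ j) :=
      fun σ => (Finset.mul_prod_erase T (fun j => y (σ j)) hl).symm
    simp_rw [e1]
    have e2 : ∑ σ : Equiv.Perm ι, y (σ l) * (y (σ l) * ∏ j ∈ T.erase l, y (σ j))
        = ∑ σ : Equiv.Perm ι, y (σ k) * (y (σ k) * ∏ j ∈ T.erase l, y (σ j)) := by
      rw [← Equiv.sum_comp (Equiv.mulRight (Equiv.swap k l))]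
      refine Finset.sum_congr rfl fun σ _ => ?_
      simp only [Equiv.coe_mulRight, Equiv.Perm.mul_apply, Equiv.swap_apply_right]
      congr 2
      refine Finset.prod_congr rfl fun j hj => ?_
      rw [Finset.mem_erase] at hj
      rw [Equiv.swap_apply_of_ne_of_ne (ne_of_mem_of_not_mem hj.2 hk) hj.1]
    have e3 : 2 * ∑ σ : Equiv.Perm ι, y (σ k) * (y (σ l) * ∏ j ∈ T.erase l, y (σ j))
        ≤ ∑ σ : Equiv.Perm ι, y (σ l) * (y (σ l) * ∏ j ∈ T.erase l, y (σ j))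
         + ∑ σ : Equiv.Perm ι, y (σ k) * (y (σ k) * ∏ j ∈ T.erase l, y (σ j)) := by
      rw [← Finset.sum_add_distrib, Finset.mul_sum]
      refine Finset.sum_le_sum fun σ _ => ?_
      have hQ : 0 ≤ ∏ j ∈ T.erase l, y (σ j) := Finset.prod_nonneg fun j _ => hy _
      nlinarith [mul_nonneg hQ (sq_nonneg (y (σ k) - y (σ l)))]
    linarith
  · apply le_of_eq
    rw [← Equiv.sum_comp (Equiv.mulRight (Equiv.swap k l))]
    refine Finset.sum_congr rfl fun σ _ => ?_
    simp only [Equiv.coe_mulRight, Equiv.Perm.mul_apply, Equiv.swap_apply_left]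
    congr 1
    refine Finset.prod_congr rfl fun j hj => ?_
    rw [Equiv.swap_apply_of_ne_of_ne (ne_of_mem_of_not_mem hj hk) (ne_of_mem_of_not_mem hj hl)]

lemma hs_perm {ι : Type} [Fintype ι] [Nonempty ι] (y : ι → ℝ) (hy : ∀ i, 0 ≤ y i) (M : ℝ)
    (hM : ∑ i, y i ≤ Fintype.card ι * M) (T : Finset ι) :
    ∑ σ : Equiv.Perm ι, ∏ j ∈ T, y (σ j) ≤ Fintype.card (Equiv.Perm ι) * M ^ T.card := by
  have hN : (0:ℝ) < Fintype.card ι := by exact_mod_cast Fintype.card_pos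
  have hM0 : 0 ≤ M := by
    have := Finset.sum_nonneg (s := Finset.univ) fun i _ => hy i
    by_contra h
    push Not at h
    nlinarith
  induction T using Finset.induction_on with
  | empty => simp [Finset.card_univ]
  | insert k T hk ih =>
    have h := hs_step y hy T k hk
    have h0 : 0 ≤ ∑ σ : Equiv.Perm ι, ∏ j ∈ T, y (σ j) :=
      Finset.sum_nonneg fun σ _ => Finset.prod_nonneg fun j _ => hy _
    have h2 := mul_le_mul_of_nonneg_right hM h0
    have h3 : (Fintype.card ι : ℝ) * ∑ σ : Equiv.Perm ι, ∏ j ∈ insert k T, y (σ j)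
       ≤ Fintype.card ι * (M * ∑ σ : Equiv.Perm ι, ∏ j ∈ T, y (σ j)) := by linarith
    have h4 := le_of_mul_le_mul_left h3 hN
    rw [Finset.card_insert_of_notMem hk, pow_succ]
    have := mul_le_mul_of_nonneg_left ih hM0
    linarith

lemma hs_avg {ι : Type} [Fintype ι] (n : ℕ) (F : Finset ι → ℝ) (T : Finset ι) (hT : T.card = n) :
    ((Finset.powersetCard n (Finset.univ : Finset ι)).card : ℝ) *
      ∑ σ : Equiv.Perm ι, F (T.map σ.toEmbedding)
    = Fintype.card (Equiv.Perm ι) * ∑ I ∈ Finset.powersetCard n (Finset.univ : Finset ι), F I := by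
  have h1 : ∀ I ∈ Finset.powersetCard n (Finset.univ : Finset ι),
      ∑ σ : Equiv.Perm ι, F (I.map σ.toEmbedding) = ∑ σ : Equiv.Perm ι, F (T.map σ.toEmbedding) := by
    intro I hI
    have hIc := (Finset.mem_powersetCard.1 hI).2
    obtain ⟨τ, hτ⟩ : ∃ τ : Equiv.Perm ι, T.map τ.toEmbedding = I := by
      let e : {x // x ∈ T} ≃ {x // x ∈ I} := Finset.equivOfCardEq (hT.trans hIc.symm)
      refine ⟨e.extendSubtype, ?_⟩
      apply Finset.eq_of_subset_of_card_le
      · intro z hz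
        obtain ⟨w, hw, rfl⟩ := Finset.mem_map.1 hz
        exact Equiv.extendSubtype_mem e w hw
      · rw [Finset.card_map, hT, hIc]
    rw [← Equiv.sum_comp (Equiv.mulRight τ) (fun σ : Equiv.Perm ι => F (T.map σ.toEmbedding))]
    refine Finset.sum_congr rfl fun σ _ => ?_
    rw [← hτ, Finset.map_map]
    rfl
  have h2 : ∀ σ : Equiv.Perm ι,
      ∑ I ∈ Finset.powersetCard n (Finset.univ : Finset ι), F (I.map σ.toEmbedding)
      = ∑ I ∈ Finset.powersetCard n (Finset.univ : Finset ι), F I := by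
    intro σ
    refine Finset.sum_nbij' (fun I => I.map σ.toEmbedding) (fun I => I.map σ.symm.toEmbedding)
      ?_ ?_ ?_ ?_ ?_
    · intro I hI; simpa [Finset.mem_powersetCard] using hI
    · intro I hI; simpa [Finset.mem_powersetCard] using hI
    · intro I _; ext; simp
    · intro I _; ext; simp
    · intro I _; rfl
  rw [← nsmul_eq_mul, ← Finset.sum_const, ← Finset.sum_congr rfl h1, Finset.sum_comm,
    Finset.sum_congr rfl (fun σ _ => h2 σ), Finset.sum_const, nsmul_eq_mul, Finset.card_univ]

lemma hs_maclaurin {ι : Type} [Fintype ι] [Nonempty ι] (n : ℕ) (hn : n ≤ Fintype.card ι)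
    (y : ι → ℝ) (hy : ∀ i, 0 ≤ y i) (M : ℝ)
    (hM : ∑ i, y i ≤ Fintype.card ι * M) :
    ∑ I ∈ Finset.powersetCard n (Finset.univ : Finset ι), ∏ i ∈ I, y i
      ≤ (Finset.powersetCard n (Finset.univ : Finset ι)).card * M ^ n := by
  obtain ⟨T, -, hT⟩ := Finset.exists_subset_card_eq (s := (Finset.univ : Finset ι)) (n := n)
    (by simpa using hn)
  have h := hs_avg n (fun I => ∏ i ∈ I, y i) T hT
  simp only [Finset.prod_map] at h
  have h2 := hs_perm y hy M hM T
  rw [hT] at h2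
  have hp : (0:ℝ) < Fintype.card (Equiv.Perm ι) := by exact_mod_cast Fintype.card_pos
  refine le_of_mul_le_mul_left ?_ hp
  rw [← h]
  calc _ ≤ ((Finset.powersetCard n (Finset.univ : Finset ι)).card : ℝ) *
      (Fintype.card (Equiv.Perm ι) * M ^ n) := mul_le_mul_of_nonneg_left h2 (by positivity)
    _ = _ := by ring

lemma hs_exp (s x : ℝ) (hx : |x| ≤ 1) : Real.exp (s * x) ≤ Real.cosh s + x * Real.sinh s := by
  have hx := abs_le.1 hx
  have h := convexOn_exp.2 (Set.mem_univ s) (Set.mem_univ (-s))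
    (show 0 ≤ (1+x)/2 by linarith) (show 0 ≤ (1-x)/2 by linarith) (by ring)
  simp only [smul_eq_mul] at h
  rw [Real.cosh_eq, Real.sinh_eq]
  have e : (1+x)/2 * s + (1-x)/2 * (-s) = s * x := by ring
  rw [e] at h
  linarith

lemma hs_tail {ι : Type} [Fintype ι] [Nonempty ι] (n : ℕ) (hn : n ≤ Fintype.card ι)
    (x : ι → ℝ) (hx : ∀ i, |x i| ≤ 1) (h0 : ∑ i, x i = 0) (d : ℝ) (hd : 0 < d) :
    (((Finset.powersetCard n (Finset.univ : Finset ι)).filter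
      (fun I => n * d < ∑ i ∈ I, x i)).card : ℝ)
    ≤ Real.exp (-(n * d ^ 2 / 2)) * (Finset.powersetCard n (Finset.univ : Finset ι)).card := by
  have h1 := hs_maclaurin n hn (fun i => Real.exp (d * x i)) (fun i => (Real.exp_pos _).le)
    (Real.exp (d ^ 2 / 2)) (by
      calc ∑ i, Real.exp (d * x i) ≤ ∑ i, (Real.cosh d + x i * Real.sinh d) :=
            Finset.sum_le_sum fun i _ => hs_exp d _ (hx i)
        _ = Fintype.card ι * Real.cosh d := by
            rw [Finset.sum_add_distrib, ← Finset.sum_mul, h0]; simp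
        _ ≤ _ := mul_le_mul_of_nonneg_left (Real.cosh_le_exp_half_sq d) (by positivity))
  have h2 : (((Finset.powersetCard n (Finset.univ : Finset ι)).filter
      (fun I => n * d < ∑ i ∈ I, x i)).card : ℝ) * Real.exp (d * (n * d))
      ≤ ∑ I ∈ Finset.powersetCard n (Finset.univ : Finset ι), ∏ i ∈ I, Real.exp (d * x i) := by
    rw [← nsmul_eq_mul, ← Finset.sum_const]
    refine le_trans (Finset.sum_le_sum fun I hI => ?_)
      (Finset.sum_le_sum_of_subset_of_nonneg (Finset.filter_subset _ _)
        fun I _ _ => Finset.prod_nonneg fun i _ => (Real.exp_pos _).le)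
    rw [← Real.exp_sum, ← Finset.mul_sum]
    exact Real.exp_le_exp.2 (mul_le_mul_of_nonneg_left (Finset.mem_filter.1 hI).2.le hd.le)
  rw [← Real.exp_nat_mul] at h1
  have h3 := h2.trans h1
  refine le_of_mul_le_mul_right (h3.trans (le_of_eq ?_)) (Real.exp_pos (d * (n * d)))
  rw [mul_right_comm, ← Real.exp_add, mul_comm]
  congr 2
  ring

lemma hs_dev {N : ℕ} (n : ℕ) (hn0 : 0 < n) (hn : n ≤ N)
    (X : Fin N → ℝ) (M : ℝ) (hM : 0 < M) (hX : ∀ i, 0 ≤ X i ∧ X i ≤ M) (d : ℝ) (hd : 0 < d) :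
    (((Finset.powersetCard n (Finset.univ : Finset (Fin N))).filter
      (fun I => ¬ |(1 / (n:ℝ)) * ∑ i ∈ I, X i - (1 / (N:ℝ)) * ∑ i, X i| ≤ d * M)).card : ℝ)
    ≤ 2 * Real.exp (-(n * d ^ 2 / 2)) *
      (Finset.powersetCard n (Finset.univ : Finset (Fin N))).card := by
  have hN : 0 < N := by omega
  have : Nonempty (Fin N) := ⟨⟨0, hN⟩⟩
  have hNr : (0:ℝ) < N := by exact_mod_cast hN
  have hnr : (0:ℝ) < n := by exact_mod_cast hn0
  set m := (1 / (N:ℝ)) * ∑ i, X i with hm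
  have hSm : ∑ i, X i = N * m := by rw [hm]; field_simp
  have hm0 : 0 ≤ m := by
    have := Finset.sum_nonneg (s := Finset.univ) fun i _ => (hX i).1
    positivity
  have hm1 : m ≤ M := by
    have : ∑ i, X i ≤ ∑ i : Fin N, M := Finset.sum_le_sum fun i _ => (hX i).2
    simp only [Finset.sum_const, Finset.card_univ, Fintype.card_fin, nsmul_eq_mul] at this
    rw [hSm] at this
    exact le_of_mul_le_mul_left this hNr
  have hb : ∀ i, |(X i - m) / M| ≤ 1 := by
    intro i
    rw [abs_div, abs_of_pos hM, div_le_one hM, abs_le]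
    constructor <;> linarith [hX i]
  have hz : ∑ i, (X i - m) / M = 0 := by
    rw [← Finset.sum_div, Finset.sum_sub_distrib, hSm]; simp
  have t1 := hs_tail n (by simpa using hn) (fun i => (X i - m) / M) hb hz d hd
  have t2 := hs_tail n (by simpa using hn) (fun i => -((X i - m) / M))
    (fun i => by rw [abs_neg]; exact hb i) (by rw [Finset.sum_neg_distrib, hz, neg_zero]) d hd
  have hsub : ((Finset.powersetCard n (Finset.univ : Finset (Fin N))).filter
      (fun I => ¬ |(1 / (n:ℝ)) * ∑ i ∈ I, X i - m| ≤ d * M)) ⊆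
      ((Finset.powersetCard n (Finset.univ : Finset (Fin N))).filter
        (fun I => n * d < ∑ i ∈ I, (X i - m) / M)) ∪
      ((Finset.powersetCard n (Finset.univ : Finset (Fin N))).filter
        (fun I => n * d < ∑ i ∈ I, -((X i - m) / M))) := by
    intro I hI
    rw [Finset.mem_filter] at hI
    obtain ⟨hI, hbad⟩ := hI
    have hc := (Finset.mem_powersetCard.1 hI).2
    have hs : ∑ i ∈ I, (X i - m) / M = n * (((1 / (n:ℝ)) * ∑ i ∈ I, X i - m) / M) := by
      rw [← Finset.sum_div, Finset.sum_sub_distrib, Finset.sum_const, hc, nsmul_eq_mul]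
      field_simp
    rw [Finset.mem_union, Finset.mem_filter, Finset.mem_filter, Finset.sum_neg_distrib, hs]
    push Not at hbad
    rcases lt_abs.1 hbad with h | h
    · left
      exact ⟨hI, mul_lt_mul_of_pos_left ((lt_div_iff₀ hM).2 h) hnr⟩
    · right
      refine ⟨hI, ?_⟩
      rw [← mul_neg, ← neg_div]
      exact mul_lt_mul_of_pos_left ((lt_div_iff₀ hM).2 h) hnr
  have hcard := (Finset.card_le_card hsub).trans (Finset.card_union_le _ _)
  have hcard' := (Nat.cast_le (α := ℝ)).2 hcard
  push_cast at hcard'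
  linarith

lemma hs_prod {M d a b a' b' : ℝ} (ha : 0 ≤ a) (haM : a ≤ M) (hbM : b' ≤ M) (hb : 0 ≤ b')
    (hM : 0 < M)
    (h1 : |a - a'| ≤ d * M) (h2 : |b - b'| ≤ d * M) : |a * b - a' * b'| ≤ 2 * d * M ^ 2 := by
  have e : a * b - a' * b' = a * (b - b') + (a - a') * b' := by ring
  rw [e]
  refine (abs_add_le _ _).trans ?_
  rw [abs_mul, abs_mul, abs_of_nonneg ha, abs_of_nonneg hb]
  have := mul_le_mul haM h2 (abs_nonneg _) hM.le
  have := mul_le_mul h1 hbM hb ((abs_nonneg _).trans h1)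
  nlinarith

lemma hs_det {c ε va vb VA VB cv CV : ℝ} (hc : 0 < c) (hε : 0 < ε) (hε1 : ε ≤ 1)
    (hA : c ≤ VA) (hB : c ≤ VB) (ha : |va - VA| ≤ ε * c / 2) (hb : |vb - VB| ≤ ε * c / 2)
    (hcv : |cv - CV| ≤ ε * c / 2) (hcs : cv ^ 2 ≤ va * vb) :
    |cv / (Real.sqrt va * Real.sqrt vb) - CV / (Real.sqrt VA * Real.sqrt VB)| ≤ ε := by
  have ha := abs_le.1 ha
  have hb := abs_le.1 hb
  have hec : ε * c ≤ c := by nlinarith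
  have hva : 0 < va := by linarith
  have hvb : 0 < vb := by linarith
  have hVA : 0 < VA := by linarith
  have hVB : 0 < VB := by linarith
  rw [← Real.sqrt_mul hva.le, ← Real.sqrt_mul hVA.le]
  set q := Real.sqrt (va * vb) with hq
  set D := Real.sqrt (VA * VB) with hD
  have hqpos : 0 < q := Real.sqrt_pos.2 (mul_pos hva hvb)
  have hDpos : 0 < D := Real.sqrt_pos.2 (mul_pos hVA hVB)
  have hDc : c ≤ D := Real.le_sqrt_of_sq_le (by nlinarith)
  have hD2 : D ^ 2 = VA * VB := Real.sq_sqrt (mul_pos hVA hVB).le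
  have hq2 : q ^ 2 = va * vb := Real.sq_sqrt (mul_pos hva hvb).le
  have hr : |cv| ≤ q := Real.abs_le_sqrt hcs
  have a1 : (1 - ε/2) * VA ≤ va := by nlinarith
  have a2 : va ≤ (1 + ε/2) * VA := by nlinarith
  have b1 : (1 - ε/2) * VB ≤ vb := by nlinarith
  have b2 : vb ≤ (1 + ε/2) * VB := by nlinarith
  have q1 : (1 - ε/2) * D ≤ q := by
    refine Real.le_sqrt_of_sq_le ?_
    have := mul_le_mul a1 b1 (by nlinarith) hva.le
    rw [mul_pow, hD2]
    linarith
  have q2 : q ≤ (1 + ε/2) * D := by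
    refine Real.sqrt_le_iff.2 ⟨by positivity, ?_⟩
    have := mul_le_mul a2 b2 hvb.le (by positivity)
    rw [mul_pow, hD2]
    linarith
  have e : cv / q - CV / D = (cv / q) * ((D - q) / D) + (cv - CV) / D := by
    field_simp
    ring
  rw [e]
  refine (abs_add_le _ _).trans ?_
  rw [abs_mul, abs_div, abs_div, abs_div, abs_of_pos hqpos, abs_of_pos hDpos]
  have r1 : |cv| / q ≤ 1 := (div_le_one hqpos).2 hr
  have r2 : |D - q| / D ≤ ε / 2 := by
    rw [div_le_iff₀ hDpos, abs_le]
    constructor <;> linarith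
  have r3 : |cv - CV| / D ≤ ε / 2 := by
    rw [div_le_iff₀ hDpos]
    nlinarith
  have := mul_le_mul r1 r2 (by positivity) zero_le_one
  linarith

lemma hs_cs {ι : Type} (I : Finset ι) (n : ℕ) (hn : 0 < n) (hI : I.card = n) (A B : ι → ℝ) :
    ((1 / (n:ℝ)) * ∑ i ∈ I, A i * B i - ((1 / (n:ℝ)) * ∑ i ∈ I, A i) * ((1 / (n:ℝ)) * ∑ i ∈ I, B i)) ^ 2
    ≤ ((1 / (n:ℝ)) * ∑ i ∈ I, (A i)^2 - ((1 / (n:ℝ)) * ∑ i ∈ I, A i) ^ 2) *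
      ((1 / (n:ℝ)) * ∑ i ∈ I, (B i)^2 - ((1 / (n:ℝ)) * ∑ i ∈ I, B i) ^ 2) := by
  have hnr : (0:ℝ) < n := by exact_mod_cast hn
  have key : ∀ X Y : ι → ℝ, (1 / (n:ℝ)) * ∑ i ∈ I, X i * Y i -
      ((1 / (n:ℝ)) * ∑ i ∈ I, X i) * ((1 / (n:ℝ)) * ∑ i ∈ I, Y i)
      = (1 / (n:ℝ)) * ∑ i ∈ I, (X i - (1 / (n:ℝ)) * ∑ i ∈ I, X i) *
        (Y i - (1 / (n:ℝ)) * ∑ i ∈ I, Y i) := by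
    intro X Y
    have h : ∀ p q : ℝ, ∑ i ∈ I, (X i - p) * (Y i - q)
        = ∑ i ∈ I, X i * Y i - q * ∑ i ∈ I, X i - p * ∑ i ∈ I, Y i + n * (p * q) := by
      intro p q
      rw [← hI, ← nsmul_eq_mul, ← Finset.sum_const, Finset.mul_sum, Finset.mul_sum,
        ← Finset.sum_sub_distrib, ← Finset.sum_sub_distrib, ← Finset.sum_add_distrib]
      exact Finset.sum_congr rfl fun i _ => by ring
    rw [h]
    field_simp
    ring
  have kA := key A A
  have kB := key B B
  simp only [← pow_two] at kA kB
  rw [key A B, kA, kB, mul_pow]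
  have := Finset.sum_mul_sq_le_sq_mul_sq I (fun i => A i - (1 / (n:ℝ)) * ∑ i ∈ I, A i)
    (fun i => B i - (1 / (n:ℝ)) * ∑ i ∈ I, B i)
  have h2 := mul_le_mul_of_nonneg_left this (sq_nonneg (1 / (n:ℝ)))
  refine h2.trans (le_of_eq ?_)
  ring

lemma hs_mean {ι : Type} (I : Finset ι) (n : ℕ) (hn : 0 < n) (hI : I.card = n) (X : ι → ℝ) (M : ℝ)
    (hX : ∀ i, 0 ≤ X i ∧ X i ≤ M) :
    0 ≤ (1 / (n:ℝ)) * ∑ i ∈ I, X i ∧ (1 / (n:ℝ)) * ∑ i ∈ I, X i ≤ M := by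
  have hnr : (0:ℝ) < n := by exact_mod_cast hn
  have h0 := Finset.sum_nonneg (s := I) fun i _ => (hX i).1
  have h1 : ∑ i ∈ I, X i ≤ ∑ i ∈ I, M := Finset.sum_le_sum fun i _ => (hX i).2
  rw [Finset.sum_const, hI, nsmul_eq_mul] at h1
  refine ⟨by positivity, ?_⟩
  rw [one_div, inv_mul_le_iff₀ hnr]
  exact h1

/-- Sample-complexity bound for join-correlation estimation: there is an absolute
constant `c₀ > 0` such that for any population of pairs `(A₁,B₁), …, (A_N,B_N)` with
entries in `[0, C]` (`C > 0`), population variances at least `c > 0`, and population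
Pearson correlation `ρ`, for any `0 < α < 1` and `0 < ε ≤ 1`, if
`n ≥ c₀·C⁴·ln(10/α)/(ε²·c²)` pairs (with `n ≤ N`) are sampled uniformly at random
without replacement and `r` is Pearson's sample correlation of the sampled pairs,
then `|r − ρ| ≤ ε` with probability at least `1 − α`. -/
theorem correlation_sample_complexity :
    ∃ c₀ : ℝ, 0 < c₀ ∧
      ∀ (N n : ℕ) (A B : Fin N → ℝ) (C c α ε : ℝ),
        0 < C →
        (∀ i, 0 ≤ A i ∧ A i ≤ C) → (∀ i, 0 ≤ B i ∧ B i ≤ C) →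
        0 < c →
        c ≤ (1 / (N : ℝ)) * ∑ i, (A i) ^ 2 - ((1 / (N : ℝ)) * ∑ i, A i) ^ 2 →
        c ≤ (1 / (N : ℝ)) * ∑ i, (B i) ^ 2 - ((1 / (N : ℝ)) * ∑ i, B i) ^ 2 →
        0 < α → α < 1 → 0 < ε → ε ≤ 1 →
        (n : ℝ) ≥ c₀ * C ^ 4 * Real.log (10 / α) / (ε ^ 2 * c ^ 2) →
        n ≤ N →
        (let μA := (1 / (N : ℝ)) * ∑ i, A i
         let μB := (1 / (N : ℝ)) * ∑ i, B i
         let νA := (1 / (N : ℝ)) * ∑ i, (A i) ^ 2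
         let νB := (1 / (N : ℝ)) * ∑ i, (B i) ^ 2
         let νAB := (1 / (N : ℝ)) * ∑ i, A i * B i
         let ρ := (νAB - μA * μB) /
           (Real.sqrt (νA - μA ^ 2) * Real.sqrt (νB - μB ^ 2))
         (((Finset.powersetCard n (Finset.univ : Finset (Fin N))).filter
             (fun I =>
               let μa := (1 / (n : ℝ)) * ∑ i ∈ I, A i
               let μb := (1 / (n : ℝ)) * ∑ i ∈ I, B i
               let νa := (1 / (n : ℝ)) * ∑ i ∈ I, (A i) ^ 2
               let νb := (1 / (n : ℝ)) * ∑ i ∈ I, (B i) ^ 2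
               let νab := (1 / (n : ℝ)) * ∑ i ∈ I, A i * B i
               let r := (νab - μa * μb) /
                 (Real.sqrt (νa - μa ^ 2) * Real.sqrt (νb - μb ^ 2))
               |r - ρ| ≤ ε)).card : ℝ)
           / ((Finset.powersetCard n (Finset.univ : Finset (Fin N))).card : ℝ)
         ≥ 1 - α) := by
  refine ⟨72, by norm_num, ?_⟩
  intro N n A B C c α ε hC hA hB hc hVA hVB hα hα1 hε hε1 hn hnN
  have hlog : 0 < Real.log (10 / α) := Real.log_pos (by rw [lt_div_iff₀ hα]; linarith)
  have hn0 : 0 < n := by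
    have : (0:ℝ) < 72 * C ^ 4 * Real.log (10 / α) / (ε ^ 2 * c ^ 2) := by positivity
    exact_mod_cast this.trans_le hn
  obtain ⟨d, hd⟩ : ∃ d, d = ε * c / (6 * C ^ 2) := ⟨_, rfl⟩
  have hd0 : 0 < d := by rw [hd]; positivity
  have hdC : d * C ^ 2 = ε * c / 6 := by rw [hd]; field_simp
  have hC2 : 0 < C ^ 2 := by positivity
  have hexp : Real.exp (-(n * d ^ 2 / 2)) ≤ α / 10 := by
    have h1 : Real.log (10 / α) ≤ n * d ^ 2 / 2 := by
      have : 72 * C ^ 4 * Real.log (10 / α) / (ε ^ 2 * c ^ 2) * d ^ 2 / 2 = Real.log (10 / α) := by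
        rw [hd]; field_simp; norm_num
      rw [← this]
      gcongr
    calc Real.exp (-(n * d ^ 2 / 2)) ≤ Real.exp (-Real.log (10 / α)) :=
          Real.exp_le_exp.2 (by linarith)
      _ = α / 10 := by
          rw [Real.exp_neg, Real.exp_log (by positivity), inv_div]
  have hA2 : ∀ i, 0 ≤ (A i) ^ 2 ∧ (A i) ^ 2 ≤ C ^ 2 := fun i =>
    ⟨sq_nonneg _, pow_le_pow_left₀ (hA i).1 (hA i).2 2⟩
  have hB2 : ∀ i, 0 ≤ (B i) ^ 2 ∧ (B i) ^ 2 ≤ C ^ 2 := fun i =>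
    ⟨sq_nonneg _, pow_le_pow_left₀ (hB i).1 (hB i).2 2⟩
  have hAB : ∀ i, 0 ≤ A i * B i ∧ A i * B i ≤ C ^ 2 := fun i =>
    ⟨mul_nonneg (hA i).1 (hB i).1, by
      rw [pow_two]; exact mul_le_mul (hA i).2 (hB i).2 (hB i).1 hC.le⟩
  have t1 := hs_dev n hn0 hnN A C hC hA d hd0
  have t2 := hs_dev n hn0 hnN B C hC hB d hd0
  have t3 := hs_dev n hn0 hnN (fun i => (A i) ^ 2) (C ^ 2) hC2 hA2 d hd0
  have t4 := hs_dev n hn0 hnN (fun i => (B i) ^ 2) (C ^ 2) hC2 hB2 d hd0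
  have t5 := hs_dev n hn0 hnN (fun i => A i * B i) (C ^ 2) hC2 hAB d hd0
  intro μA μB νA νB νAB ρ
  have hP : (0:ℝ) < (Finset.powersetCard n (Finset.univ : Finset (Fin N))).card := by
    rw [Finset.card_powersetCard]
    exact_mod_cast Nat.choose_pos (by simpa using hnN)
  rw [ge_iff_le, le_div_iff₀ hP]
  have mA := hs_mean Finset.univ N (by omega) (by simp) A C hA
  have mB := hs_mean Finset.univ N (by omega) (by simp) B C hB
  have main : ∀ I ∈ Finset.powersetCard n (Finset.univ : Finset (Fin N)),
      |(1 / (n:ℝ)) * ∑ i ∈ I, A i - (1 / (N:ℝ)) * ∑ i, A i| ≤ d * C →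
      |(1 / (n:ℝ)) * ∑ i ∈ I, B i - (1 / (N:ℝ)) * ∑ i, B i| ≤ d * C →
      |(1 / (n:ℝ)) * ∑ i ∈ I, (A i) ^ 2 - (1 / (N:ℝ)) * ∑ i, (A i) ^ 2| ≤ d * C ^ 2 →
      |(1 / (n:ℝ)) * ∑ i ∈ I, (B i) ^ 2 - (1 / (N:ℝ)) * ∑ i, (B i) ^ 2| ≤ d * C ^ 2 →
      |(1 / (n:ℝ)) * ∑ i ∈ I, A i * B i - (1 / (N:ℝ)) * ∑ i, A i * B i| ≤ d * C ^ 2 →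
      |((1 / (n:ℝ)) * ∑ i ∈ I, A i * B i -
          ((1 / (n:ℝ)) * ∑ i ∈ I, A i) * ((1 / (n:ℝ)) * ∑ i ∈ I, B i)) /
        (Real.sqrt ((1 / (n:ℝ)) * ∑ i ∈ I, (A i) ^ 2 - ((1 / (n:ℝ)) * ∑ i ∈ I, A i) ^ 2) *
         Real.sqrt ((1 / (n:ℝ)) * ∑ i ∈ I, (B i) ^ 2 - ((1 / (n:ℝ)) * ∑ i ∈ I, B i) ^ 2)) - ρ|
        ≤ ε := by
    intro I hI h1 h2 h3 h4 h5
    have hc' := (Finset.mem_powersetCard.1 hI).2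
    have ma := hs_mean I n hn0 hc' A C hA
    have mb := hs_mean I n hn0 hc' B C hB
    have pab := abs_le.1 (hs_prod ma.1 ma.2 mB.2 mB.1 hC h1 h2)
    have paa := abs_le.1 (hs_prod ma.1 ma.2 mA.2 mA.1 hC h1 h1)
    have pbb := abs_le.1 (hs_prod mb.1 mb.2 mB.2 mB.1 hC h2 h2)
    have h3 := abs_le.1 h3
    have h4 := abs_le.1 h4
    have h5 := abs_le.1 h5
    refine hs_det hc hε hε1 hVA hVB ?_ ?_ ?_ (hs_cs I n hn0 hc' A B)
    · rw [abs_le, pow_two ((1 / (n:ℝ)) * ∑ i ∈ I, A i), pow_two ((1 / (N:ℝ)) * ∑ i, A i)]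
      constructor <;> linarith
    · rw [abs_le, pow_two ((1 / (n:ℝ)) * ∑ i ∈ I, B i), pow_two ((1 / (N:ℝ)) * ∑ i, B i)]
      constructor <;> linarith
    · rw [abs_le]
      constructor <;> linarith
  suffices H : ∀ G : Finset (Finset (Fin N)),
      (∀ I ∈ Finset.powersetCard n (Finset.univ : Finset (Fin N)),
      |(1 / (n:ℝ)) * ∑ i ∈ I, A i - (1 / (N:ℝ)) * ∑ i, A i| ≤ d * C →
      |(1 / (n:ℝ)) * ∑ i ∈ I, B i - (1 / (N:ℝ)) * ∑ i, B i| ≤ d * C →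
      |(1 / (n:ℝ)) * ∑ i ∈ I, (A i) ^ 2 - (1 / (N:ℝ)) * ∑ i, (A i) ^ 2| ≤ d * C ^ 2 →
      |(1 / (n:ℝ)) * ∑ i ∈ I, (B i) ^ 2 - (1 / (N:ℝ)) * ∑ i, (B i) ^ 2| ≤ d * C ^ 2 →
      |(1 / (n:ℝ)) * ∑ i ∈ I, A i * B i - (1 / (N:ℝ)) * ∑ i, A i * B i| ≤ d * C ^ 2 → I ∈ G) →
      (1 - α) * ((Finset.powersetCard n (Finset.univ : Finset (Fin N))).card : ℝ) ≤ (G.card : ℝ) from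
    H _ (fun I hI g1 g2 g3 g4 g5 => Finset.mem_filter.2 ⟨hI, main I hI g1 g2 g3 g4 g5⟩)
  intro G hG
  let Bd : (Fin N → ℝ) → ℝ → Finset (Finset (Fin N)) := fun X M =>
    (Finset.powersetCard n (Finset.univ : Finset (Fin N))).filter
      (fun I => ¬ |(1 / (n:ℝ)) * ∑ i ∈ I, X i - (1 / (N:ℝ)) * ∑ i, X i| ≤ d * M)
  have hcov : Finset.powersetCard n (Finset.univ : Finset (Fin N)) ⊆
      G ∪ (Bd A C ∪ (Bd B C ∪ (Bd (fun i => (A i) ^ 2) (C ^ 2) ∪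
        (Bd (fun i => (B i) ^ 2) (C ^ 2) ∪ Bd (fun i => A i * B i) (C ^ 2))))) := by
    intro I hI
    by_cases g1 : |(1 / (n:ℝ)) * ∑ i ∈ I, A i - (1 / (N:ℝ)) * ∑ i, A i| ≤ d * C
    swap
    · exact Finset.mem_union_right _ (Finset.mem_union_left _ (Finset.mem_filter.2 ⟨hI, g1⟩))
    by_cases g2 : |(1 / (n:ℝ)) * ∑ i ∈ I, B i - (1 / (N:ℝ)) * ∑ i, B i| ≤ d * C
    swap
    · exact Finset.mem_union_right _ (Finset.mem_union_right _ (Finset.mem_union_left _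
        (Finset.mem_filter.2 ⟨hI, g2⟩)))
    by_cases g3 : |(1 / (n:ℝ)) * ∑ i ∈ I, (A i) ^ 2 - (1 / (N:ℝ)) * ∑ i, (A i) ^ 2| ≤ d * C ^ 2
    swap
    · exact Finset.mem_union_right _ (Finset.mem_union_right _ (Finset.mem_union_right _
        (Finset.mem_union_left _ (Finset.mem_filter.2 ⟨hI, g3⟩))))
    by_cases g4 : |(1 / (n:ℝ)) * ∑ i ∈ I, (B i) ^ 2 - (1 / (N:ℝ)) * ∑ i, (B i) ^ 2| ≤ d * C ^ 2
    swap
    · exact Finset.mem_union_right _ (Finset.mem_union_right _ (Finset.mem_union_right _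
        (Finset.mem_union_right _ (Finset.mem_union_left _ (Finset.mem_filter.2 ⟨hI, g4⟩)))))
    by_cases g5 : |(1 / (n:ℝ)) * ∑ i ∈ I, A i * B i - (1 / (N:ℝ)) * ∑ i, A i * B i| ≤ d * C ^ 2
    swap
    · exact Finset.mem_union_right _ (Finset.mem_union_right _ (Finset.mem_union_right _
        (Finset.mem_union_right _ (Finset.mem_union_right _ (Finset.mem_filter.2 ⟨hI, g5⟩)))))
    exact Finset.mem_union_left _ (hG I hI g1 g2 g3 g4 g5)
  have hcard : (Finset.powersetCard n (Finset.univ : Finset (Fin N))).card ≤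
      G.card + ((Bd A C).card + ((Bd B C).card + ((Bd (fun i => (A i) ^ 2) (C ^ 2)).card +
        ((Bd (fun i => (B i) ^ 2) (C ^ 2)).card + (Bd (fun i => A i * B i) (C ^ 2)).card)))) := by
    refine (Finset.card_le_card hcov).trans ?_
    refine (Finset.card_union_le _ _).trans (Nat.add_le_add_left ?_ _)
    refine (Finset.card_union_le _ _).trans (Nat.add_le_add_left ?_ _)
    refine (Finset.card_union_le _ _).trans (Nat.add_le_add_left ?_ _)
    refine (Finset.card_union_le _ _).trans (Nat.add_le_add_left ?_ _)
    exact Finset.card_union_le _ _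
  have hcard' := (Nat.cast_le (α := ℝ)).2 hcard
  simp only [Nat.cast_add] at hcard'
  change ((Bd A C).card : ℝ) ≤ _ at t1
  change ((Bd B C).card : ℝ) ≤ _ at t2
  change ((Bd (fun i => (A i) ^ 2) (C ^ 2)).card : ℝ) ≤ _ at t3
  change ((Bd (fun i => (B i) ^ 2) (C ^ 2)).card : ℝ) ≤ _ at t4
  change ((Bd (fun i => A i * B i) (C ^ 2)).card : ℝ) ≤ _ at t5
  have hfin := mul_le_mul_of_nonneg_right hexp hP.le
  linarith
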